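/- arXiv:1804.03759 — 2 statements merged into one kernel-verified Lean document; each statement's English description precedes it below -/
import Mathlib

section
/- Let G = (𝒱, E) be a finite connected simple graph that is a ZV-line graph w.r.t. a ZV-ordered partition ⟨Z, V_1, …, V_k⟩, and let x = (x_1,…,x_n) be a location profile whose ballots do not all belong to one common set V_i. Then the set PO(x) ∩ Z is nonempty, and, letting w denote its leftmost element, for every location v ∈ Z such that some agent i strictly prefers v over w (i.e., d(x_i, v) < d(x_i, w)), the location w lies strictly to the left of v in the order on Z. -/
/- Common framework: finite connected simple graphs, shortest-path distance,
   profiles as lists of vertices, mechanisms as functions `List α → α`,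
   anonymity, Pareto optimality, and group-manipulation-resistance. -/

open Classical

noncomputable section

/-- The ball of radius `r` around `v`. -/
def ball {α : Type} (G : SimpleGraph α) (v : α) (r : ℕ) : Set α :=
  {u | G.dist v u ≤ r}

/-- Distance from a vertex to a (nonempty) set of vertices. -/
def distToSet {α : Type} (G : SimpleGraph α) (v : α) (Z : Finset α) : ℕ :=
  sInf ((fun z => G.dist v z) '' (Z : Set α))

/-- An agent located at `ℓ` weakly prefers `a` over `b`. -/
def wPref {α : Type} (G : SimpleGraph α) (ℓ a b : α) : Prop := G.dist ℓ a ≤ G.dist ℓ b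

/-- An agent located at `ℓ` strictly prefers `a` over `b`. -/
def sPref {α : Type} (G : SimpleGraph α) (ℓ a b : α) : Prop := G.dist ℓ a < G.dist ℓ b

/-- `u` Pareto dominates `v` w.r.t. the profile `x`. -/
def Dominates {α : Type} (G : SimpleGraph α) (x : List α) (u v : α) : Prop :=
  (∀ a ∈ x, wPref G a u v) ∧ (∃ a ∈ x, sPref G a u v)

/-- The set of Pareto optimal locations for a profile `x`. -/
def PO {α : Type} (G : SimpleGraph α) (x : List α) : Set α :=
  {v | ¬ ∃ u, Dominates G x u v}

/-- A mechanism is anonymous if its outcome is invariant under permutations of ballots. -/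
def Anonymous {α : Type} (F : List α → α) : Prop :=
  ∀ x y : List α, x.Perm y → F x = F y

/-- A mechanism is Pareto optimal if its outcome is always Pareto optimal. -/
def ParetoOptimal {α : Type} (G : SimpleGraph α) (F : List α → α) : Prop :=
  ∀ x : List α, F x ∈ PO G x

/-- The list of ballots `x j` for agents `j` outside the coalition `C`. -/
def profileMinus {α : Type} {n : ℕ} (x : Fin n → α) (C : Finset (Fin n)) : List α :=
  ((List.finRange n).filter (fun i => decide (i ∉ C))).map x

/-- Group-manipulation-resistance where all sincere ballots and all manipulated
ballots are required to lie in the set `S`. -/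
def GMRon {α : Type} (G : SimpleGraph α) (S : Set α) (F : List α → α) : Prop :=
  ¬ ∃ (n : ℕ) (x : Fin n → α) (C : Finset (Fin n)) (A : List α),
      (∀ i, x i ∈ S) ∧ (∀ a ∈ A, a ∈ S) ∧
      (∀ i ∈ C, wPref G (x i) (F (A ++ profileMinus x C)) (F (List.ofFn x))) ∧
      (∃ i ∈ C, sPref G (x i) (F (A ++ profileMinus x C)) (F (List.ofFn x)))

/-- Group-manipulation-resistance: no coalition `C` can, by replacing its ballots
with an arbitrary finite tuple `A` of ballots (misreporting, false-name voting,
or abstaining), obtain an outcome that all its members weakly prefer and at least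
one member strictly prefers. -/
def GMR {α : Type} (G : SimpleGraph α) (F : List α → α) : Prop :=
  ¬ ∃ (n : ℕ) (x : Fin n → α) (C : Finset (Fin n)) (A : List α),
      (∀ i ∈ C, wPref G (x i) (F (A ++ profileMinus x C)) (F (List.ofFn x))) ∧
      (∃ i ∈ C, sPref G (x i) (F (A ++ profileMinus x C)) (F (List.ofFn x)))

/-- `A` is an interval in `Z` (w.r.t. the order injection `ord`): it is a subset
of `Z` that is order-convex within `Z`. -/
def IsIntervalIn {α : Type} (ord : α → ℝ) (Z : Finset α) (A : Set α) : Prop :=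
  A ⊆ (Z : Set α) ∧
  ∀ a ∈ A, ∀ b ∈ A, ∀ c ∈ Z, ord a ≤ ord c → ord c ≤ ord b → c ∈ A

/-- A ZV-ordered partition ⟨Z, V₁, …, V_k⟩ of a connected graph `G`, together with
the order (injection into ℝ) on `Z` and the roots of the `Vᵢ`. -/
structure ZVPartition {α : Type} (G : SimpleGraph α) where
  hconn : G.Connected
  k : ℕ
  Z : Finset α
  Vs : Fin k → Finset α
  ord : α → ℝ
  Z_nonempty : Z.Nonempty
  Vs_nonempty : ∀ i, (Vs i).Nonempty
  ord_inj : Set.InjOn ord (Z : Set α)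
  Vs_disjoint : ∀ i j, i ≠ j → Disjoint (Vs i) (Vs j)
  cover : ∀ v : α, v ∈ Z ∨ ∃ i, v ∈ Vs i
  no_drop_Z : ¬ ∀ v : α, ∃ i, v ∈ Vs i
  no_drop_Vs : ∀ i : Fin k, ¬ ∀ v : α, v ∈ Z ∨ ∃ j, j ≠ i ∧ v ∈ Vs j
  root : Fin k → α
  root_mem : ∀ i, root i ∈ Vs i
  root_min : ∀ i, ∀ u ∈ Vs i, distToSet G (root i) Z ≤ distToSet G u Z
  root_unique : ∀ i, ∀ u ∈ Vs i, (∀ w ∈ Vs i, distToSet G u Z ≤ distToSet G w Z) → u = root i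
  separation : ∀ i : Fin k, ∀ u ∈ Vs i, ∀ v : α, v ∉ Vs i →
      ∀ p : G.Walk u v, root i ∈ p.support ∧ ∃ z ∈ Z, z ∈ p.support

/-- `G` is a ZV-line graph w.r.t. the ZV-ordered partition `P`: balls of radius 1
around Z-vertices meet `Z` in intervals, each induced subgraph on `Vᵢ` is
recursively a ZV-line graph whose Z-set contains the root of `Vᵢ` as its leftmost
element, and balls of radius 1 around the roots meet `Z` in intervals. -/
inductive IsZVLineGraph : {β : Type} → {H : SimpleGraph β} → ZVPartition H → Prop
  | mk {β : Type} {H : SimpleGraph β} (P : ZVPartition H)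
      (hb : ∀ z ∈ P.Z, IsIntervalIn P.ord P.Z (ball H z 1 ∩ (P.Z : Set β)))
      (Q : ∀ i : Fin P.k, ZVPartition (H.induce ((P.Vs i : Finset β) : Set β)))
      (hQ : ∀ i, IsZVLineGraph (Q i))
      (hroot : ∀ i : Fin P.k, ∃ h : P.root i ∈ ((P.Vs i : Finset β) : Set β),
          (⟨P.root i, h⟩ : ((P.Vs i : Finset β) : Set β)) ∈ (Q i).Z ∧
          ∀ z ∈ (Q i).Z, (Q i).ord ⟨P.root i, h⟩ ≤ (Q i).ord z)
      (hballroot : ∀ i, IsIntervalIn P.ord P.Z (ball H (P.root i) 1 ∩ (P.Z : Set β))) :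
      IsZVLineGraph P

namespace SimpleGraph

variable {α : Type} {G : SimpleGraph α}

/-- A geodesic splits at each of its vertices into two geodesics. -/
lemma Walk.dist_add_dist_of_mem_support {u v r : α} (p : G.Walk u v)
    (hp : p.length = G.dist u v) (hr : r ∈ p.support) :
    G.dist u r + G.dist r v ≤ G.dist u v := by
  have h := congrArg Walk.length (p.take_spec hr)
  rw [Walk.length_append] at h
  have h₁ := dist_le (p.takeUntil r hr)
  have h₂ := dist_le (p.dropUntil r hr)
  omega

/-- In a connected graph, some neighbour of `u` is the first step of a geodesic to `v ≠ u`. -/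
lemma Connected.exists_adj_dist_succ (hG : G.Connected) {u v : α} (huv : u ≠ v) :
    ∃ t, G.Adj u t ∧ G.dist u v = G.dist t v + 1 := by
  obtain ⟨p, hp⟩ := hG.exists_walk_length_eq_dist u v
  cases p with
  | nil => exact absurd rfl huv
  | cons h q =>
    rename_i t
    refine ⟨t, h, ?_⟩
    have h₁ := dist_le q
    have h₂ := hG.dist_triangle (u := u) (v := t) (w := v)
    have h₃ := dist_eq_one_iff_adj.mpr h
    rw [Walk.length_cons] at hp
    omega

end SimpleGraph

namespace ZVPartition

variable {α : Type} {G : SimpleGraph α} (P : ZVPartition G)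

lemma eq_root_of_mem_Z {i : Fin P.k} {u : α} (hu : u ∈ P.Vs i) (hZ : u ∈ P.Z) :
    u = P.root i := by
  refine P.root_unique i u hu fun w _ => ?_
  have h : distToSet G u P.Z = 0 := Nat.sInf_eq_zero.mpr (Or.inl ⟨u, hZ, by simp⟩)
  omega

lemma dist_root_add_dist_le {i : Fin P.k} {u t : α} (hu : u ∈ P.Vs i) (ht : t ∉ P.Vs i) :
    G.dist u (P.root i) + G.dist (P.root i) t ≤ G.dist u t := by
  obtain ⟨p, hp⟩ := P.hconn.exists_walk_length_eq_dist u t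
  exact p.dist_add_dist_of_mem_support hp (P.separation i u hu t ht p).1

lemma dist_root_add_dist_le_of_mem_Z {i : Fin P.k} {u z : α} (hu : u ∈ P.Vs i) (hz : z ∈ P.Z) :
    G.dist u (P.root i) + G.dist (P.root i) z ≤ G.dist u z := by
  by_cases h : z ∈ P.Vs i
  · rw [P.eq_root_of_mem_Z h hz]
    simp
  · exact P.dist_root_add_dist_le hu h

/-- Seen from outside `Vᵢ`, every vertex of `Vᵢ` outside `Z` lies behind a vertex of `Z`. -/
lemma exists_mem_Z_dist_lt {i : Fin P.k} {y t : α} (hy : y ∈ P.Vs i) (hyZ : y ∉ P.Z)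
    (ht : t ∉ P.Vs i) : ∃ z ∈ P.Z, G.dist t z < G.dist t y := by
  obtain ⟨p, hp⟩ := P.hconn.exists_walk_length_eq_dist y t
  obtain ⟨z, hz, hzp⟩ := (P.separation i y hy t ht p).2
  have h := p.dist_add_dist_of_mem_support hp hzp
  have hpos : 0 < G.dist y z := P.hconn.pos_dist_of_ne fun h => hyZ (h ▸ hz)
  refine ⟨z, hz, ?_⟩
  rw [G.dist_comm (u := t) (v := z), G.dist_comm (u := t) (v := y)]
  omega

/-- A geodesic from a root outside `Z` to a vertex outside `Vᵢ` starts with a step into `Z`. -/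
lemma exists_step_of_root_notMem_Z {i : Fin P.k} {t : α} (hr : P.root i ∉ P.Z)
    (ht : t ∉ P.Vs i) :
    ∃ u ∈ P.Z, G.Adj (P.root i) u ∧ G.dist (P.root i) t = G.dist u t + 1 := by
  have hne : P.root i ≠ t := fun h => ht (h ▸ P.root_mem i)
  obtain ⟨u, hadj, hd⟩ := P.hconn.exists_adj_dist_succ hne
  refine ⟨u, ?_, hadj, hd⟩
  have hu : u ∉ P.Vs i := fun hu => by
    have := P.dist_root_add_dist_le hu ht
    omega
  obtain ⟨z, hz, hzp⟩ := (P.separation i _ (P.root_mem i) u hu hadj.toWalk).2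
  have : z = P.root i ∨ z = u := by simpa using hzp
  rcases this with rfl | rfl
  · exact absurd hz hr
  · exact hz

/-- If unit balls around `Z`-vertices and roots meet `Z` in intervals, all balls do. -/
lemma dist_le_of_between
    (hb : ∀ z ∈ P.Z, IsIntervalIn P.ord P.Z (ball G z 1 ∩ (P.Z : Set α)))
    (hr : ∀ i, IsIntervalIn P.ord P.Z (ball G (P.root i) 1 ∩ (P.Z : Set α)))
    (n : ℕ) {v a b c : α} (ha : a ∈ P.Z) (hbZ : b ∈ P.Z) (hc : c ∈ P.Z)
    (hac : P.ord a ≤ P.ord c) (hcb : P.ord c ≤ P.ord b)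
    (hva : G.dist v a ≤ n) (hvb : G.dist v b ≤ n) : G.dist v c ≤ n := by
  induction n using Nat.strong_induction_on generalizing v a b c with
  | _ n ih =>
  have hG := P.hconn
  rcases Nat.eq_zero_or_pos n with rfl | hn
  · have h₁ : v = a := hG.dist_eq_zero_iff.mp (by omega)
    have h₂ : v = b := hG.dist_eq_zero_iff.mp (by omega)
    subst h₁ h₂
    rw [P.ord_inj hc ha (le_antisymm hcb hac)]
    exact hva
  obtain ⟨m, rfl⟩ : ∃ m, n = m + 1 := ⟨n - 1, by omega⟩
  by_cases hv : v ∈ P.Z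
  · rcases Nat.eq_zero_or_pos m with rfl | hm
    · exact ((hb v hv).2 a ⟨hva, ha⟩ b ⟨hvb, hbZ⟩ c hc hac hcb).1
    have step : ∀ e, G.dist v e ≤ m + 1 →
        ∃ u, G.dist v u ≤ 1 ∧ G.dist u v ≤ 1 ∧ G.dist u e ≤ m := by
      intro e hve
      by_cases h : v = e
      · subst h
        exact ⟨v, by simp⟩
      · obtain ⟨u, hu, hd⟩ := hG.exists_adj_dist_succ h
        exact ⟨u, (SimpleGraph.dist_eq_one_iff_adj.mpr hu).le,
          (SimpleGraph.dist_eq_one_iff_adj.mpr hu.symm).le, by omega⟩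
    rcases le_total (P.ord c) (P.ord v) with h | h
    · obtain ⟨u, h₁, h₂, h₃⟩ := step a hva
      have h₄ := ih m (by omega) ha hv hc hac h h₃ (by omega)
      have := hG.dist_triangle (u := v) (v := u) (w := c)
      omega
    · obtain ⟨u, h₁, h₂, h₃⟩ := step b hvb
      have h₄ := ih m (by omega) hv hbZ hc h hcb (by omega) h₃
      have := hG.dist_triangle (u := v) (v := u) (w := c)
      omega
  obtain ⟨i, hi⟩ := (P.cover v).resolve_left hv
  by_cases hvr : v = P.root i
  · have hrZ : P.root i ∉ P.Z := hvr ▸ hv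
    have hout : ∀ e ∈ P.Z, e ∉ P.Vs i := fun e he h =>
      hrZ (P.eq_root_of_mem_Z h he ▸ he)
    rw [hvr] at hva hvb ⊢
    obtain ⟨u, hu, huadj, hud⟩ := P.exists_step_of_root_notMem_Z hrZ (hout a ha)
    obtain ⟨t, ht, htadj, htd⟩ := P.exists_step_of_root_notMem_Z hrZ (hout b hbZ)
    have hu₁ := SimpleGraph.dist_eq_one_iff_adj.mpr huadj
    have ht₁ := SimpleGraph.dist_eq_one_iff_adj.mpr htadj
    have hu₀ : G.dist u u = 0 := SimpleGraph.dist_self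
    have ht₀ : G.dist t t = 0 := SimpleGraph.dist_self
    rcases le_total (P.ord c) (P.ord u) with h | h
    · have h₄ := ih m (by omega) ha hu hc hac h (v := u) (by omega) (by omega)
      have := hG.dist_triangle (u := P.root i) (v := u) (w := c)
      omega
    rcases le_total (P.ord c) (P.ord t) with h' | h'
    · have h₄ : G.dist (P.root i) c ≤ 1 :=
        ((hr i).2 u ⟨hu₁.le, hu⟩ t ⟨ht₁.le, ht⟩ c hc h h').1
      omega
    · have h₄ := ih m (by omega) ht hbZ hc h' hcb (v := t) (by omega) (by omega)
      have := hG.dist_triangle (u := P.root i) (v := t) (w := c)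
      omega
  · have hpos := hG.pos_dist_of_ne hvr
    have h₁ := P.dist_root_add_dist_le_of_mem_Z hi ha
    have h₂ := P.dist_root_add_dist_le_of_mem_Z hi hbZ
    have h₃ := ih (m + 1 - G.dist v (P.root i)) (by omega) ha hbZ hc hac hcb
      (v := P.root i) (by omega) (by omega)
    have := hG.dist_triangle (u := v) (v := P.root i) (w := c)
    omega

/-- Among the `Z`-vertices closest to `a`, and then closest to `b`, one is not Pareto dominated
by any vertex of `Z`. -/
lemma exists_undominated_in_Z {x : List α} {a b : α} (ha : a ∈ x) (hb : b ∈ x) :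
    ∃ z ∈ P.Z, (∀ z' ∈ P.Z, G.dist a z ≤ G.dist a z') ∧
      (∀ z' ∈ P.Z, G.dist a z' ≤ G.dist a z → G.dist b z ≤ G.dist b z') ∧
      ∀ z' ∈ P.Z, ¬ Dominates G x z' z := by
  obtain ⟨z, hz, hmin⟩ := P.Z.exists_min_image
    (fun z => toLex (G.dist a z, toLex (G.dist b z, (x.map fun c => G.dist c z).sum)))
    P.Z_nonempty
  simp only [Prod.Lex.toLex_le_toLex] at hmin
  refine ⟨z, hz, fun z' hz' => ?_, fun z' hz' h => ?_, fun z' hz' hdom => ?_⟩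
  · rcases hmin z' hz' with h | h
    · exact h.le
    · exact h.1.le
  · rcases hmin z' hz' with h' | ⟨_, h' | h'⟩
    · omega
    · exact h'.le
    · exact h'.1.le
  · have h₁ : G.dist a z' ≤ G.dist a z := hdom.1 a ha
    have h₂ : G.dist b z' ≤ G.dist b z := hdom.1 b hb
    have h₃ : (x.map fun c => G.dist c z').sum < (x.map fun c => G.dist c z).sum :=
      List.sum_lt_sum _ _ hdom.1 hdom.2
    rcases hmin z' hz' with h' | ⟨_, h' | h'⟩ <;> omega

/-- If the ballots do not all lie in one `Vᵢ`, each agent has a Pareto optimal location among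
the locations of `Z` that it likes best. -/
lemma exists_pareto_closest_in_Z {x : List α}
    (hx : ¬ ∃ i : Fin P.k, ∀ a ∈ x, a ∈ P.Vs i) {a : α} (ha : a ∈ x) :
    ∃ z ∈ P.Z, z ∈ PO G x ∧ ∀ z' ∈ P.Z, G.dist a z ≤ G.dist a z' := by
  obtain ⟨b, hb, hab⟩ : ∃ b ∈ x, ∀ i, a ∈ P.Vs i → b ∉ P.Vs i := by
    by_cases h : ∃ i, a ∈ P.Vs i
    · obtain ⟨i, hi⟩ := h
      push Not at hx
      obtain ⟨b, hb, hbi⟩ := hx i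
      refine ⟨b, hb, fun j hj => ?_⟩
      obtain rfl : j = i := by
        by_contra hne
        exact Finset.disjoint_left.mp (P.Vs_disjoint j i hne) hj hi
      exact hbi
    · exact ⟨a, ha, fun i hi => absurd ⟨i, hi⟩ h⟩
  obtain ⟨z, hz, hmin, hminb, hund⟩ := P.exists_undominated_in_Z ha hb
  refine ⟨z, hz, ?_, hmin⟩
  rintro ⟨y, hy⟩
  have hyZ : y ∉ P.Z := fun h => hund y h hy
  have hya : G.dist a y ≤ G.dist a z := hy.1 a ha
  have hyb : G.dist b y ≤ G.dist b z := hy.1 b hb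
  obtain ⟨i, hi⟩ := (P.cover y).resolve_left hyZ
  by_cases hai : a ∈ P.Vs i
  · have hbi := hab i hai
    have hyr := P.dist_root_add_dist_le hi hbi
    rw [G.dist_comm (u := y) (v := b)] at hyr
    by_cases hr : P.root i ∈ P.Z
    · have h₁ := P.dist_root_add_dist_le_of_mem_Z hai hz
      have h₂ := hminb _ hr (by omega)
      have h₃ : 0 < G.dist y (P.root i) := P.hconn.pos_dist_of_ne fun h => hyZ (h ▸ hr)
      rw [G.dist_comm (u := P.root i) (v := b)] at hyr
      omega
    · obtain ⟨u, hu, hadj, hd⟩ := P.exists_step_of_root_notMem_Z hr hbi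
      have h₁ := P.dist_root_add_dist_le_of_mem_Z hai hz
      have h₂ : 0 < G.dist (P.root i) z := P.hconn.pos_dist_of_ne fun h => hr (h ▸ hz)
      have h₃ := P.hconn.dist_triangle (u := a) (v := P.root i) (w := u)
      have h₄ := SimpleGraph.dist_eq_one_iff_adj.mpr hadj
      have h₅ := hminb u hu (by omega)
      rw [G.dist_comm (u := u) (v := b)] at hd
      omega
  · obtain ⟨z', hz', hlt⟩ := P.exists_mem_Z_dist_lt hi hyZ hai
    have := hmin z' hz'
    omega

end ZVPartition

/-- Let `G` be a finite connected ZV-line graph w.r.t. `P` and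
let `x` be a profile whose ballots do not all belong to one common set `Vᵢ`.
Then `PO(x) ∩ Z` is nonempty, and its leftmost element `w` lies strictly to the
left of every location `v ∈ Z` that some agent strictly prefers over `w`. -/
theorem leftmost_pareto_in_Z
    {α : Type} [Fintype α] (G : SimpleGraph α) (P : ZVPartition G)
    (hZV : IsZVLineGraph P)
    (x : List α) (hx : ¬ ∃ i : Fin P.k, ∀ a ∈ x, a ∈ P.Vs i) :
    (PO G x ∩ (P.Z : Set α)).Nonempty ∧
    ∀ w, w ∈ PO G x → w ∈ P.Z →
      (∀ w' ∈ P.Z, w' ∈ PO G x → P.ord w ≤ P.ord w') →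
      ∀ v ∈ P.Z, (∃ a ∈ x, sPref G a v w) → P.ord w < P.ord v := by
  constructor
  · rcases x.eq_nil_or_concat with rfl | ⟨l, a, rfl⟩
    · obtain ⟨z, hz⟩ := P.Z_nonempty
      exact ⟨z, by simp [PO, Dominates], hz⟩
    · obtain ⟨z, hz, hPO, _⟩ := P.exists_pareto_closest_in_Z hx (a := a) (by simp)
      exact ⟨z, hPO, hz⟩
  · rintro w _ hw hleft v hv ⟨a, ha, hlt⟩
    by_contra! hvw
    obtain ⟨z, hz, hPO, hmin⟩ := P.exists_pareto_closest_in_Z hx ha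
    have hle : G.dist a w ≤ G.dist a v := by
      cases hZV with
      | mk _ hb _ _ _ hr =>
        exact P.dist_le_of_between hb hr _ hv hz hw hvw (hleft z hz hPO) le_rfl (hmin v hv)
    exact absurd hlt (not_lt.mpr hle)
end
end

section
/- Let G = (𝒱, E) be a finite connected block graph, let v_0 ∈ 𝒱 be a predefined vertex, and let ≺ be a predefined linear order on 𝒱. Then the mechanism F that maps each nonempty location profile x to the ≺-first element of argmin_{v ∈ PO(x)} d(v, v_0) (the Pareto optimal location closest to v_0, ties broken according to ≺) is anonymous, Pareto optimal, and group-manipulation-resistant. -/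
/- Common framework: finite connected simple graphs, shortest-path distance,
   profiles as lists of vertices, mechanisms as functions `List α → α`,
   anonymity, Pareto optimality, and group-manipulation-resistance. -/

open Classical

noncomputable section

/-- A block graph: for every four vertices, the two larger of the three pairwise
distance sums are equal. -/
def IsBlockGraph {α : Type} (G : SimpleGraph α) : Prop :=
  ∀ u v w x : α,
    (G.dist u v + G.dist w x ≤ G.dist u w + G.dist v x →
     G.dist u v + G.dist w x ≤ G.dist u x + G.dist v w →
     G.dist u w + G.dist v x = G.dist u x + G.dist v w) ∧
    (G.dist u w + G.dist v x ≤ G.dist u v + G.dist w x →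
     G.dist u w + G.dist v x ≤ G.dist u x + G.dist v w →
     G.dist u v + G.dist w x = G.dist u x + G.dist v w) ∧
    (G.dist u x + G.dist v w ≤ G.dist u v + G.dist w x →
     G.dist u x + G.dist v w ≤ G.dist u w + G.dist v x →
     G.dist u v + G.dist w x = G.dist u w + G.dist v x)

theorem SimpleGraph.Connected.exists_adj_dist_add_one_eq {α : Type} {G : SimpleGraph α}
    (hconn : G.Connected) {a f : α} (hne : 0 < G.dist a f) :
    ∃ w, G.dist f w = 1 ∧ G.dist a w + 1 = G.dist a f := by
  obtain ⟨p, hp⟩ := hconn.exists_walk_length_eq_dist f a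
  rw [G.dist_comm] at hp
  cases p with
  | nil => simp at hne
  | @cons _ w _ h q =>
    have hfw : G.dist f w = 1 := SimpleGraph.dist_eq_one_iff_adj.mpr h
    have hq := SimpleGraph.dist_le q
    have htri := hconn.dist_triangle (u := a) (v := w) (w := f)
    rw [SimpleGraph.Walk.length_cons] at hp
    rw [G.dist_comm (u := w) (v := f)] at htri
    rw [G.dist_comm (u := w) (v := a)] at hq
    exact ⟨w, hfw, by omega⟩

/-- Geodesics in a block graph are unique. -/
theorem IsBlockGraph.eq_of_dist_add_dist_eq {α : Type} {G : SimpleGraph α}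
    (hconn : G.Connected) (hblock : IsBlockGraph G) {a b u w : α}
    (hw : G.dist a w + G.dist w b = G.dist a b)
    (hua : G.dist a u ≤ G.dist a w) (hub : G.dist u b ≤ G.dist w b) : u = w := by
  have h := hblock a b u w
  have htri := hconn.dist_triangle (u := a) (v := u) (w := b)
  rw [G.dist_comm (u := b) (v := u), G.dist_comm (u := b) (v := w)] at h
  exact hconn.dist_eq_zero_iff.mp (by omega)

theorem IsBlockGraph.mem_PO_of_dist_add_dist_eq {α : Type} {G : SimpleGraph α}
    (hconn : G.Connected) (hblock : IsBlockGraph G) {x : List α} {a b w : α}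
    (ha : a ∈ x) (hb : b ∈ x) (hw : G.dist a w + G.dist w b = G.dist a b) :
    w ∈ PO G x := by
  rintro ⟨u, hle, c, -, hc⟩
  have hbu : G.dist b u ≤ G.dist b w := hle b hb
  rw [G.dist_comm (u := b) (v := u), G.dist_comm (u := b) (v := w)] at hbu
  obtain rfl := hblock.eq_of_dist_add_dist_eq hconn hw (hle a ha) hbu
  exact lt_irrefl _ hc

/-- A neighbour of a Pareto optimal location in the direction of an agent is Pareto optimal. -/
theorem IsBlockGraph.mem_PO_of_dist_eq_one {α : Type} {G : SimpleGraph α}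
    (hconn : G.Connected) (hblock : IsBlockGraph G) {x : List α} {a f w : α}
    (ha : a ∈ x) (hf : f ∈ PO G x) (hfw : G.dist f w = 1)
    (haw : G.dist a w + 1 = G.dist a f) : w ∈ PO G x := by
  obtain ⟨b, hb, hlt⟩ : ∃ b ∈ x, G.dist b f < G.dist b w := by
    by_contra! hall
    exact hf ⟨w, hall, a, ha, show G.dist a w < G.dist a f by omega⟩
  refine hblock.mem_PO_of_dist_add_dist_eq hconn ha hb ?_
  have h := hblock a w f b
  have htri := hconn.dist_triangle (u := b) (v := f) (w := w)
  rw [G.dist_comm (u := w) (v := f), G.dist_comm (u := w) (v := b), G.dist_comm (u := f) (v := b)] at h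
  rw [G.dist_comm (u := w) (v := b)]
  omega

/-- A location that some agent strictly prefers to a Pareto optimal location closest to `v₀` is
no closer to `v₀`, and is itself Pareto optimal if it is equally close. -/
theorem IsBlockGraph.dist_le_of_sPref {α : Type} {G : SimpleGraph α}
    (hconn : G.Connected) (hblock : IsBlockGraph G) {v₀ : α} {x : List α} {a f g : α}
    (ha : a ∈ x) (hf : f ∈ PO G x) (hmin : ∀ v ∈ PO G x, G.dist f v₀ ≤ G.dist v v₀)
    (hg : sPref G a g f) :
    G.dist f v₀ ≤ G.dist g v₀ ∧ (G.dist f v₀ = G.dist g v₀ → g ∈ PO G x) := by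
  unfold sPref at hg
  obtain ⟨w, hfw, haw⟩ := hconn.exists_adj_dist_add_one_eq (a := a) (f := f) (by omega)
  have hwPO := hblock.mem_PO_of_dist_eq_one hconn ha hf hfw haw
  have hw := hmin w hwPO
  have hag := hconn.dist_triangle (u := a) (v := g) (w := v₀)
  have hwf := hconn.dist_triangle (u := w) (v := f) (w := v₀)
  have h := hblock a w f v₀
  rw [G.dist_comm (u := w) (v := f)] at h hwf
  refine ⟨by omega, fun heq => ?_⟩
  have hgw : g = w :=
    hblock.eq_of_dist_add_dist_eq hconn (a := a) (b := v₀) (by omega) (by omega) (by omega)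
  exact hgw ▸ hwPO

theorem PO_congr {α : Type} (G : SimpleGraph α) {x y : List α} (h : ∀ a, a ∈ x ↔ a ∈ y) :
    PO G x = PO G y := by
  simp only [PO, Dominates, h]

theorem PO_nil {α : Type} (G : SimpleGraph α) : PO G [] = Set.univ := by
  simp [PO, Dominates]

theorem mem_profileMinus {α : Type} {n : ℕ} {x : Fin n → α} {C : Finset (Fin n)} {i : Fin n}
    (hi : i ∉ C) : x i ∈ profileMinus x C := by
  simp only [profileMinus, List.mem_map, List.mem_filter]
  exact ⟨i, ⟨List.mem_finRange i, by simpa using hi⟩, rfl⟩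

/-- Let `G` be a finite connected block graph, `v₀` a
predefined vertex, and `≺` (the strict order of `L`) a predefined linear order
on the vertices. Then the mechanism mapping each nonempty profile to the
`≺`-first Pareto optimal location closest to `v₀` is anonymous, Pareto optimal,
and group-manipulation-resistant. -/
theorem blockGraph_closest_pareto_mechanism
    {α : Type} [Fintype α] (G : SimpleGraph α) (hconn : G.Connected)
    (hblock : IsBlockGraph G) (v₀ : α) (L : LinearOrder α) (F : List α → α)
    (hF : ∀ x : List α, x ≠ [] →
        F x ∈ PO G x ∧
        (∀ v ∈ PO G x, G.dist (F x) v₀ ≤ G.dist v v₀) ∧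
        (∀ v ∈ PO G x, (∀ u ∈ PO G x, G.dist v v₀ ≤ G.dist u v₀) → v ≠ F x → L.lt (F x) v)) :
    Anonymous F ∧ ParetoOptimal G F ∧ GMR G F := by
  have hlt : ∀ {x : List α} {a g : α}, a ∈ x → sPref G a g (F x) →
      G.dist (F x) v₀ ≤ G.dist g v₀ ∧ (G.dist (F x) v₀ = G.dist g v₀ → L.lt (F x) g) := by
    intro x a g ha hg
    obtain ⟨hPO, hmin, htie⟩ := hF x (List.ne_nil_of_mem ha)
    obtain ⟨hle, hmem⟩ := hblock.dist_le_of_sPref hconn ha hPO hmin hg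
    refine ⟨hle, fun heq => htie g (hmem heq) (fun u hu => heq ▸ hmin u hu) ?_⟩
    rintro rfl
    exact lt_irrefl _ hg
  have hPO : ParetoOptimal G F := by
    intro x
    by_cases hx : x = []
    · simp [hx, PO_nil]
    · exact (hF x hx).1
  refine ⟨fun x y hxy => ?_, hPO, ?_⟩
  · by_cases hx : x = []
    · subst hx
      rw [hxy.nil_eq]
    · have hy : y ≠ [] := fun hy => hx (by subst hy; exact hxy.eq_nil)
      obtain ⟨hx₁, hx₂, hx₃⟩ := hF x hx
      obtain ⟨hy₁, hy₂, hy₃⟩ := hF y hy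
      rw [← PO_congr G fun _ => hxy.mem_iff] at hy₁ hy₂ hy₃
      by_contra hne
      exact @lt_asymm α L.toPreorder _ _ (hx₃ _ hy₁ hy₂ (Ne.symm hne)) (hy₃ _ hx₁ hx₂ hne)
  · rintro ⟨n, x, C, A, hweak, i, hi, hstrict⟩
    have hmem : ∀ j, x j ∈ List.ofFn x := fun j => (List.mem_ofFn' x _).mpr ⟨j, rfl⟩
    obtain ⟨k, hk⟩ : ∃ k, sPref G (x k) (F (List.ofFn x)) (F (A ++ profileMinus x C)) := by
      by_contra! hall
      refine hPO (List.ofFn x) ⟨F (A ++ profileMinus x C), fun a ha => ?_, x i, hmem i, hstrict⟩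
      obtain ⟨j, rfl⟩ := (List.mem_ofFn' x a).mp ha
      exact not_lt.mp (hall j)
    have hkC : k ∉ C := fun hkC => not_lt.mpr (hweak k hkC) hk
    obtain ⟨hle, htie⟩ := hlt (hmem i) hstrict
    obtain ⟨hle', htie'⟩ := hlt (List.mem_append_right A (mem_profileMinus hkC)) hk
    have heq := le_antisymm hle hle'
    exact @lt_asymm α L.toPreorder _ _ (htie heq) (htie' heq.symm)
end
end
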